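/- arXiv:1308.2793 — 3 statements merged into one kernel-verified Lean document; each statement's English description precedes it below -/
import Mathlib

section
/- For every dimension d ≥ 1 there exists a constant K1 ∈ N, depending on d only, such that for every Δ ∈ (0,∞), every ℓ ∈ (0,∞), and every continuous, piecewise C¹ path w in R^d of length at most ℓ, the number of k ∈ ΔZ^d such that the range of w intersects the Δ-block B_Δ(k) is at most K1·⌈ℓ/Δ⌉. -/
open Set

/-- The Δ-block with lower-left corner `Δ·k`, `k ∈ ℤ^d`:
`∏_{i=1}^d [Δ kᵢ, Δ kᵢ + Δ) ⊂ ℝ^d`. -/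
def deltaBlock (d : ℕ) (Δ : ℝ) (k : Fin d → ℤ) : Set (EuclideanSpace ℝ (Fin d)) :=
  {x | ∀ i, Δ * (k i : ℝ) ≤ x i ∧ x i < Δ * (k i : ℝ) + Δ}

/-- `w : [0,1] → ℝ^d` is piecewise C¹: there is a finite partition of `[0,1]` on whose
pieces `w` is continuously differentiable. -/
def PiecewiseC1 (d : ℕ) (w : ℝ → EuclideanSpace ℝ (Fin d)) : Prop :=
  ∃ (n : ℕ) (t : ℕ → ℝ), t 0 = 0 ∧ t n = 1 ∧ Monotone t ∧
    ∀ i < n, ContDiffOn ℝ 1 w (Set.Icc (t i) (t (i + 1)))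

theorem blocks_class_le (d : ℕ) (Δ : ℝ) (hΔ : 0 < Δ) (S : Set (Fin d → ℤ))
    (h : ∀ k ∈ S, ∀ k' ∈ S, ∃ x ∈ deltaBlock d Δ k, ∃ y ∈ deltaBlock d Δ k', dist x y < Δ) :
    S.encard ≤ (3 ^ d : ℕ) := by
  rcases S.eq_empty_or_nonempty with rfl | ⟨k0, hk0⟩
  · simp
  have hsub : S ⊆ ((Fintype.piFinset fun i => Finset.Icc (k0 i - 1) (k0 i + 1) :
      Finset (Fin d → ℤ)) : Set (Fin d → ℤ)) := by
    intro k hk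
    obtain ⟨x, hx, y, hy, hxy⟩ := h k hk k0 hk0
    simp only [Finset.mem_coe, Fintype.mem_piFinset, Finset.mem_Icc]
    intro i
    have h1 : |x i - y i| < Δ := by
      have := PiLp.norm_apply_le (x - y) i
      rw [← dist_eq_norm] at this
      simpa using lt_of_le_of_lt this hxy
    rw [abs_lt] at h1
    obtain ⟨a1, a2⟩ := hx i
    obtain ⟨b1, b2⟩ := hy i
    have c1 : (k i : ℝ) < k0 i + 2 := by
      by_contra hc
      push Not at hc
      nlinarith [mul_le_mul_of_nonneg_left hc hΔ.le]
    have c2 : (k0 i : ℝ) < k i + 2 := by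
      by_contra hc
      push Not at hc
      nlinarith [mul_le_mul_of_nonneg_left hc hΔ.le]
    have c1' : k i < k0 i + 2 := by exact_mod_cast c1
    have c2' : k0 i < k i + 2 := by exact_mod_cast c2
    omega
  refine (Set.encard_le_encard hsub).trans ?_
  rw [Set.encard_coe_eq_coe_finsetCard, Fintype.card_piFinset]
  have : ∀ i, (Finset.Icc (k0 i - 1) (k0 i + 1)).card = 3 := by
    intro i; rw [Int.card_Icc]; omega
  simp [this]

theorem encard_range_union_le {α : Type*} (S : ℕ → Set α) (c : ℕ) (h : ∀ j, (S j).encard ≤ c)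
    (n : ℕ) : {a | ∃ j < n, a ∈ S j}.encard ≤ (n * c : ℕ) := by
  induction n with
  | zero => simp
  | succ n ih =>
    have : {a | ∃ j < n + 1, a ∈ S j} ⊆ {a | ∃ j < n, a ∈ S j} ∪ S n := by
      rintro a ⟨j, hj, ha⟩
      rcases Nat.lt_succ_iff_lt_or_eq.mp hj with h1 | rfl
      · exact Or.inl ⟨j, h1, ha⟩
      · exact Or.inr ha
    refine (Set.encard_le_encard this).trans ((Set.encard_union_le _ _).trans ?_)
    refine (add_le_add ih (h n)).trans ?_
    rw [← Nat.cast_add]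
    exact_mod_cast (by ring_nf; exact le_rfl)

/-- For every `d ≥ 1` there is `K1 ∈ ℕ`, depending on `d` only, such that
any continuous, piecewise C¹ path in `ℝ^d` of length (total variation) at most `ℓ`
intersects at most `K1 ⌈ℓ/Δ⌉` Δ-blocks. -/
theorem card_blocks_intersected_by_path_le (d : ℕ) (hd : 1 ≤ d) :
    ∃ K1 : ℕ, ∀ (Δ ℓ : ℝ), 0 < Δ → 0 < ℓ →
      ∀ w : ℝ → EuclideanSpace ℝ (Fin d),
        ContinuousOn w (Set.Icc 0 1) →
        PiecewiseC1 d w →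
        eVariationOn w (Set.Icc 0 1) ≤ ENNReal.ofReal ℓ →
        {k : Fin d → ℤ | (w '' Set.Icc 0 1 ∩ deltaBlock d Δ k).Nonempty}.encard ≤
          (K1 * Nat.ceil (ℓ / Δ) : ℕ) := by
  refine ⟨2 * 3 ^ d, ?_⟩
  intro Δ ℓ hΔ hℓ w _ _ hw
  set V : ℝ → ℝ := fun t => (eVariationOn w (Set.Icc 0 t)).toReal with hV
  have hle : ∀ t ∈ Set.Icc (0 : ℝ) 1, eVariationOn w (Set.Icc 0 t) ≤ ENNReal.ofReal ℓ :=
    fun t ht => (eVariationOn.mono w (Set.Icc_subset_Icc_right ht.2)).trans hw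
  have hVle : ∀ t ∈ Set.Icc (0 : ℝ) 1, V t ≤ ℓ := fun t ht =>
    ENNReal.toReal_le_of_le_ofReal hℓ.le (hle t ht)
  have hdist : ∀ s ∈ Set.Icc (0 : ℝ) 1, ∀ t ∈ Set.Icc (0 : ℝ) 1, s ≤ t →
      dist (w s) (w t) ≤ V t - V s := by
    intro s hs t ht hst
    have h1 := eVariationOn.Icc_add_Icc w (s := Set.univ) hs.1 hst (Set.mem_univ s)
    simp only [Set.univ_inter] at h1
    have h2 : edist (w s) (w t) ≤ eVariationOn w (Set.Icc s t) :=
      eVariationOn.edist_le w ⟨le_rfl, hst⟩ ⟨hst, le_rfl⟩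
    have h3 : eVariationOn w (Set.Icc 0 s) + edist (w s) (w t) ≤ eVariationOn w (Set.Icc 0 t) :=
      h1 ▸ add_le_add le_rfl h2
    have h4 := ENNReal.toReal_mono (ne_top_of_le_ne_top ENNReal.ofReal_ne_top (hle t ht)) h3
    rw [ENNReal.toReal_add (ne_top_of_le_ne_top ENNReal.ofReal_ne_top (hle s hs))
      (edist_ne_top _ _), ← dist_edist] at h4
    simp only [hV]
    linarith
  have hV0 : ∀ t, 0 ≤ V t := fun t => ENNReal.toReal_nonneg
  set S : ℕ → Set (Fin d → ℤ) := fun j =>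
    {k | ∃ t ∈ Set.Icc (0 : ℝ) 1, ⌊V t / Δ⌋₊ = j ∧ w t ∈ deltaBlock d Δ k} with hS
  have hSc : ∀ j, (S j).encard ≤ (3 ^ d : ℕ) := by
    intro j
    apply blocks_class_le d Δ hΔ
    rintro k ⟨s, hs, hsj, hsk⟩ k' ⟨t, ht, htj, htk⟩
    refine ⟨w s, hsk, w t, htk, ?_⟩
    have b : ∀ r, ⌊V r / Δ⌋₊ = j → j * Δ ≤ V r ∧ V r < (j + 1) * Δ := by
      intro r hr
      rw [Nat.floor_eq_iff (div_nonneg (hV0 r) hΔ.le), le_div_iff₀ hΔ, div_lt_iff₀ hΔ] at hr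
      exact hr
    have bs := b s hsj
    have bt := b t htj
    rcases le_total s t with hst | hst
    · have := hdist s hs t ht hst
      linarith
    · have := hdist t ht s hs hst
      rw [dist_comm]
      linarith
  have hn : 1 ≤ ⌈ℓ / Δ⌉₊ := Nat.one_le_ceil_iff.mpr (div_pos hℓ hΔ)
  have hsub : {k : Fin d → ℤ | (w '' Set.Icc 0 1 ∩ deltaBlock d Δ k).Nonempty} ⊆
      {k | ∃ j < ⌈ℓ / Δ⌉₊ + 1, k ∈ S j} := by
    rintro k ⟨_, ⟨t, ht, rfl⟩, hk⟩
    refine ⟨⌊V t / Δ⌋₊, ?_, t, ht, rfl, hk⟩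
    refine Nat.lt_succ_of_le ((Nat.floor_le_ceil _).trans (Nat.ceil_mono ?_))
    exact div_le_div_of_nonneg_right (hVle t ht) hΔ.le
  refine (Set.encard_le_encard hsub).trans ((encard_range_union_le S _ hSc _).trans ?_)
  have : (⌈ℓ / Δ⌉₊ + 1) * 3 ^ d ≤ 2 * 3 ^ d * ⌈ℓ / Δ⌉₊ := by
    nlinarith [Nat.mul_le_mul_right (3 ^ d) hn]
  exact_mod_cast this
end

section
/- For every dimension d ≥ 1 there exists a constant K1 ∈ N, depending on d only, such that for every Δ ∈ (0,∞), every ℓ ∈ (0,∞), and every continuous, piecewise C¹ path w in R^d starting at 0 of length at most ℓ, the union U of all Δ-blocks intersected by the range of w is a topologically connected subset of R^d, contains the origin, and is a union of at most K1·⌈ℓ/Δ⌉ distinct Δ-blocks. -/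
open Set

theorem deltaBlock_iff (d : ℕ) (Δ : ℝ) (hΔ : 0 < Δ) (k : Fin d → ℤ)
    (x : EuclideanSpace ℝ (Fin d)) :
    x ∈ deltaBlock d Δ k ↔ k = fun i => ⌊x i / Δ⌋ := by
  constructor
  · intro h
    funext i
    obtain ⟨h1, h2⟩ := h i
    symm
    rw [Int.floor_eq_iff]
    constructor
    · rw [le_div_iff₀ hΔ]; linarith
    · rw [div_lt_iff₀ hΔ]; linarith
  · rintro rfl i
    have h1 := Int.floor_le (x i / Δ)
    have h2 := Int.lt_floor_add_one (x i / Δ)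
    rw [le_div_iff₀ hΔ] at h1
    rw [div_lt_iff₀ hΔ] at h2
    constructor <;> dsimp only <;> linarith

theorem deltaBlock_convex (d : ℕ) (Δ : ℝ) (k : Fin d → ℤ) :
    Convex ℝ (deltaBlock d Δ k) := by
  intro x hx y hy a b ha hb hab i
  have h := (convex_Ico (𝕜 := ℝ) (Δ * (k i : ℝ)) (Δ * (k i : ℝ) + Δ)) (hx i) (hy i) ha hb hab
  simpa using h

theorem floor_close (a b Δ : ℝ) (hΔ : 0 < Δ) (h : |a - b| < Δ) :
    ⌊a / Δ⌋ - ⌊b / Δ⌋ ∈ Finset.Icc (-1 : ℤ) 1 := by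
  have h3 : |a / Δ - b / Δ| < 1 := by
    rw [← sub_div, abs_div, abs_of_pos hΔ, div_lt_one hΔ]; exact h
  rw [abs_lt] at h3
  have h1 := Int.floor_le (a / Δ)
  have h2 := Int.lt_floor_add_one (a / Δ)
  have h4 := Int.floor_le (b / Δ)
  have h5 := Int.lt_floor_add_one (b / Δ)
  have h6 : ((⌊a / Δ⌋ - ⌊b / Δ⌋ : ℤ) : ℝ) < ((2 : ℤ) : ℝ) := by push_cast; linarith
  have h7 : ((-2 : ℤ) : ℝ) < ((⌊a / Δ⌋ - ⌊b / Δ⌋ : ℤ) : ℝ) := by push_cast; linarith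
  have h8 := Int.cast_lt.mp h6
  have h9 := Int.cast_lt.mp h7
  rw [Finset.mem_Icc]
  constructor <;> omega

theorem exists_index {E : Type*} [PseudoMetricSpace E] (w : ℝ → E) (Δ ℓ : ℝ)
    (hΔ : 0 < Δ) (hℓ : 0 < ℓ)
    (hv : eVariationOn w (Set.Icc 0 1) ≤ ENNReal.ofReal ℓ) :
    ∃ J : ℝ → ℕ, (∀ t ∈ Set.Icc (0 : ℝ) 1, J t < Nat.ceil (ℓ / Δ) + 1) ∧
      ∀ s ∈ Set.Icc (0 : ℝ) 1, ∀ t ∈ Set.Icc (0 : ℝ) 1, J s = J t → dist (w s) (w t) < Δ := by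
  have hle : ∀ t ∈ Set.Icc (0 : ℝ) 1, eVariationOn w (Set.Icc 0 t) ≤ ENNReal.ofReal ℓ :=
    fun t ht => (eVariationOn.mono w (Set.Icc_subset_Icc_right ht.2)).trans hv
  set V : ℝ → ℝ := fun t => (eVariationOn w (Set.Icc 0 t)).toReal with hV
  have hV0 : ∀ t, 0 ≤ V t := fun t => ENNReal.toReal_nonneg
  have key : ∀ s ∈ Set.Icc (0 : ℝ) 1, ∀ t ∈ Set.Icc (0 : ℝ) 1, s ≤ t →
      dist (w s) (w t) ≤ V t - V s := by
    intro s hs t ht hst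
    have hadd := eVariationOn.Icc_add_Icc w (s := Set.univ) hs.1 hst (Set.mem_univ s)
    simp only [Set.univ_inter] at hadd
    have hd : edist (w s) (w t) ≤ eVariationOn w (Set.Icc s t) :=
      eVariationOn.edist_le w ⟨le_rfl, hst⟩ ⟨hst, le_rfl⟩
    have hft : eVariationOn w (Set.Icc 0 t) ≠ ⊤ :=
      ((hle t ht).trans_lt ENNReal.ofReal_lt_top).ne
    have h1 : eVariationOn w (Set.Icc 0 s) + edist (w s) (w t) ≤ eVariationOn w (Set.Icc 0 t) := by
      rw [← hadd]; gcongr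
    have h2 := ENNReal.toReal_mono hft h1
    rw [ENNReal.toReal_add ((hle s hs).trans_lt ENNReal.ofReal_lt_top).ne (edist_ne_top _ _),
      ← dist_edist] at h2
    simp only [hV]; linarith
  have close : ∀ s t, ⌊V s / Δ⌋₊ = ⌊V t / Δ⌋₊ → V t - V s < Δ := by
    intro s t h
    have h1 := Nat.floor_le (div_nonneg (hV0 s) hΔ.le)
    have h2 := Nat.lt_floor_add_one (V t / Δ)
    rw [← h] at h2
    have h3 : V t / Δ < V s / Δ + 1 := by linarith
    rw [← sub_lt_iff_lt_add', ← sub_div, div_lt_one hΔ] at h3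
    exact h3
  refine ⟨fun t => ⌊V t / Δ⌋₊, ?_, ?_⟩
  · intro t ht
    have h1 : V t ≤ ℓ := ENNReal.toReal_le_of_le_ofReal hℓ.le (hle t ht)
    rw [Nat.lt_succ_iff]
    exact (Nat.floor_le_floor (by gcongr)).trans (Nat.floor_le_ceil _)
  · intro s hs t ht h
    rcases le_total s t with hst | hst
    · exact (key s hs t ht hst).trans_lt (close s t h)
    · rw [dist_comm]
      exact (key t ht s hs hst).trans_lt (close t s h.symm)

theorem exists_finset (d : ℕ) (Δ ℓ : ℝ) (hΔ : 0 < Δ) (hℓ : 0 < ℓ)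
    (w : ℝ → EuclideanSpace ℝ (Fin d))
    (hv : eVariationOn w (Set.Icc 0 1) ≤ ENNReal.ofReal ℓ) :
    ∃ A : Finset (Fin d → ℤ), A.card ≤ (2 * 3 ^ d) * Nat.ceil (ℓ / Δ) ∧
      ∀ k, k ∈ A ↔ (w '' Set.Icc 0 1 ∩ deltaBlock d Δ k).Nonempty := by
  classical
  obtain ⟨J, hJ1, hJ2⟩ := exists_index w Δ ℓ hΔ hℓ hv
  have hr : ∀ j : ℕ, ∃ r : ℝ, ∀ t ∈ Set.Icc (0 : ℝ) 1, J t = j → r ∈ Set.Icc (0 : ℝ) 1 ∧ J r = j := by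
    intro j
    by_cases h : ∃ t ∈ Set.Icc (0 : ℝ) 1, J t = j
    · obtain ⟨t, ht⟩ := h
      exact ⟨t, fun _ _ _ => ht⟩
    · exact ⟨0, fun t ht hj => (h ⟨t, ht, hj⟩).elim⟩
  choose r hr using hr
  let P : Finset (ℕ × (Fin d → ℤ)) :=
    Finset.range (Nat.ceil (ℓ / Δ) + 1) ×ˢ Fintype.piFinset fun _ => Finset.Icc (-1 : ℤ) 1
  let B : Finset (Fin d → ℤ) := P.image fun p i => ⌊w (r p.1) i / Δ⌋ + p.2 i
  have hBc : B.card ≤ (2 * 3 ^ d) * Nat.ceil (ℓ / Δ) := by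
    refine Finset.card_image_le.trans ?_
    have hc : 1 ≤ Nat.ceil (ℓ / Δ) := Nat.ceil_pos.mpr (div_pos hℓ hΔ)
    have : P.card = (Nat.ceil (ℓ / Δ) + 1) * 3 ^ d := by
      simp [P, Finset.card_product, Fintype.card_piFinset]
    rw [this]
    nlinarith [Nat.zero_le (3 ^ d)]
  refine ⟨B.filter fun k => (w '' Set.Icc 0 1 ∩ deltaBlock d Δ k).Nonempty,
    (Finset.card_filter_le _ _).trans hBc, fun k => ?_⟩
  rw [Finset.mem_filter, and_iff_right_iff_imp]
  rintro ⟨_, ⟨t, ht, rfl⟩, hk⟩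
  rw [deltaBlock_iff d Δ hΔ] at hk
  subst hk
  obtain ⟨h1, h2⟩ := hr (J t) t ht rfl
  refine Finset.mem_image.mpr ⟨(J t, fun i => ⌊w t i / Δ⌋ - ⌊w (r (J t)) i / Δ⌋), ?_, ?_⟩
  · refine Finset.mem_product.mpr ⟨Finset.mem_range.mpr (hJ1 t ht), ?_⟩
    refine Fintype.mem_piFinset.mpr fun i => floor_close _ _ _ hΔ ?_
    have h3 := hJ2 t ht _ h1 h2.symm
    rw [dist_eq_norm] at h3
    have h4 := PiLp.norm_apply_le (w t - w (r (J t))) i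
    rw [Real.norm_eq_abs] at h4
    exact lt_of_le_of_lt (by simpa using h4) h3
  · funext i; simp

/-- For every `d ≥ 1` there is `K1 ∈ ℕ`, depending on `d` only, such that
for every `Δ > 0`, `ℓ > 0` and every continuous piecewise C¹ path `w` starting at `0`
of length at most `ℓ`, the union `U` of all Δ-blocks intersected by the range of `w`
is connected, contains the origin, and is a union of at most `K1 ⌈ℓ/Δ⌉` distinct
Δ-blocks. -/
theorem union_blocks_intersected_connected (d : ℕ) (hd : 1 ≤ d) :
    ∃ K1 : ℕ, ∀ (Δ ℓ : ℝ), 0 < Δ → 0 < ℓ →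
      ∀ w : ℝ → EuclideanSpace ℝ (Fin d),
        w 0 = 0 →
        ContinuousOn w (Set.Icc 0 1) →
        PiecewiseC1 d w →
        eVariationOn w (Set.Icc 0 1) ≤ ENNReal.ofReal ℓ →
        IsConnected
            (⋃ k ∈ {k : Fin d → ℤ | (w '' Set.Icc 0 1 ∩ deltaBlock d Δ k).Nonempty},
              deltaBlock d Δ k) ∧
          (0 : EuclideanSpace ℝ (Fin d)) ∈
            (⋃ k ∈ {k : Fin d → ℤ | (w '' Set.Icc 0 1 ∩ deltaBlock d Δ k).Nonempty},
              deltaBlock d Δ k) ∧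
          ∃ A : Finset (Fin d → ℤ), A.card ≤ K1 * Nat.ceil (ℓ / Δ) ∧
            (⋃ k ∈ {k : Fin d → ℤ | (w '' Set.Icc 0 1 ∩ deltaBlock d Δ k).Nonempty},
              deltaBlock d Δ k) = ⋃ k ∈ A, deltaBlock d Δ k := by
  refine ⟨2 * 3 ^ d, fun Δ ℓ hΔ hℓ w h0 hc _ hv => ?_⟩
  have hmem : ∀ t ∈ Set.Icc (0 : ℝ) 1, w t ∈
      (⋃ k ∈ {k : Fin d → ℤ | (w '' Set.Icc 0 1 ∩ deltaBlock d Δ k).Nonempty},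
              deltaBlock d Δ k) := by
    intro t ht
    have h1 := (deltaBlock_iff d Δ hΔ _ (w t)).mpr rfl
    exact Set.mem_biUnion (show _ ∈ {k | _} from ⟨w t, ⟨t, ht, rfl⟩, h1⟩) h1
  have h00 : (0 : ℝ) ∈ Set.Icc (0 : ℝ) 1 := ⟨le_rfl, zero_le_one⟩
  have hm0 := hmem 0 h00
  refine ⟨⟨⟨_, hm0⟩, ?_⟩, h0 ▸ hm0, ?_⟩
  · refine isPreconnected_of_forall (w 0) fun y hy => ?_
    obtain ⟨k, hk, hyk⟩ := Set.mem_iUnion₂.mp hy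
    refine ⟨w '' Set.Icc 0 1 ∪ deltaBlock d Δ k, ?_, Or.inl ⟨0, h00, rfl⟩, Or.inr hyk, ?_⟩
    · rintro x (⟨t, ht, rfl⟩ | hx)
      · exact hmem t ht
      · exact Set.mem_biUnion hk hx
    · obtain ⟨z, hz1, hz2⟩ := hk
      exact IsPreconnected.union z hz1 hz2 (isPreconnected_Icc.image w hc)
        (deltaBlock_convex d Δ k).isPreconnected
  · obtain ⟨A, hA, hA2⟩ := exists_finset d Δ ℓ hΔ hℓ w hv
    refine ⟨A, hA, ?_⟩
    ext x
    simp only [Set.mem_iUnion, Set.mem_setOf_eq, hA2]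
end

section
/- Fix an integer N₀ ≥ 2 and set ω_r := N₀^r, Δ_r := N₀^{6r} and ρ̄_r := ∏_{k=1}^{r} (1 − N₀^{−k/4}) for r ∈ N. For t ≥ 0 let q_t(z) := P( N⁺ − N⁻ = z ) for z ∈ Z, where N⁺, N⁻ are independent Poisson random variables each with mean t (the time-t transition kernel of the continuous-time simple symmetric random walk on Z jumping to each neighbour at rate 1). Then there exists r₀ ∈ N, depending only on N₀, such that for all r ≥ r₀ the following holds. Let η : Z → {0,1} be any configuration such that Σ_{y=x'}^{x'+ω_{r+1}−1} η(y) ≥ (1 − ρ̄_{r+1})·ω_{r+1} for every x' ∈ Z with [x', x'+ω_{r+1}) ⊆ [−5Δ_{r+1}, 6Δ_{r+1}). Then for every integer x ∈ [−Δ_{r+1}, 2Δ_{r+1}) and every real t ∈ [Δ_{r+1}, 3Δ_{r+1}), Σ_{z∈Z} (1 − η(z)) · Σ_{y=x}^{x+ω_r−1} q_t(y − z) ≤ 1 + ρ̄_{r+1}·ω_r. -/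
open Finset

/-- `skellam t z = P(N⁺ − N⁻ = z)` for independent Poisson(`t`) variables `N⁺, N⁻`:
the time-`t` transition kernel of the continuous-time simple symmetric random walk on
`ℤ` jumping to each neighbour at rate 1. -/
noncomputable def skellam (t : ℝ) (z : ℤ) : ℝ :=
  ∑' p : ℕ × ℕ,
    if (p.1 : ℤ) - (p.2 : ℤ) = z then
      (Real.exp (-t) * t ^ p.1 / (Nat.factorial p.1)) *
        (Real.exp (-t) * t ^ p.2 / (Nat.factorial p.2))
    else 0

/-- `ρ̄_r = ∏_{k=1}^r (1 − N₀^{−k/4})`. -/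
noncomputable def rhoBar (N₀ : ℕ) (r : ℕ) : ℝ :=
  ∏ k ∈ Finset.Icc 1 r, (1 - (N₀ : ℝ) ^ (-(k : ℝ) / 4))

lemma hasSum_conv {β : Type*} {f g : β → ℝ} {a b : ℝ} (h : HasSum f a) (hf : ∀ x, g x = f x)
    (hab : b = a) : HasSum g b := by
  rw [hab, show g = f from funext hf]
  exact h


noncomputable def pois (t : ℝ) (n : ℕ) : ℝ := Real.exp (-t) * t ^ n / (Nat.factorial n)

lemma pois_nonneg {t : ℝ} (ht : 0 < t) (n : ℕ) : 0 ≤ pois t n := by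
  unfold pois; positivity

lemma pois_succ (t : ℝ) (n : ℕ) : pois t (n + 1) * ((n + 1 : ℕ) : ℝ) = t * pois t n := by
  unfold pois
  rw [Nat.factorial_succ, pow_succ]
  have : (Nat.factorial n : ℝ) ≠ 0 := by positivity
  push_cast
  field_simp

lemma pois_hasSum (t : ℝ) : HasSum (pois t) 1 := by
  have h := (NormedSpace.expSeries_div_hasSum_exp (𝔸 := ℝ) t).mul_left (Real.exp (-t))
  rw [← Real.exp_eq_exp_ℝ, ← Real.exp_add] at h
  simp only [neg_add_cancel, Real.exp_zero] at h
  refine hasSum_conv h ?_ rfl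
  intro n
  unfold pois
  ring

lemma pois_hasSum1 (t : ℝ) : HasSum (fun n : ℕ => pois t n * n) t := by
  rw [← hasSum_nat_add_iff' 1]
  simp only [pois_succ, Finset.range_one, Finset.sum_singleton, Nat.cast_zero, mul_zero, sub_zero]
  simpa using (pois_hasSum t).mul_left t

lemma pois_hasSum2 (t : ℝ) : HasSum (fun n : ℕ => pois t n * n * (n - 1)) (t ^ 2) := by
  rw [← hasSum_nat_add_iff' 1]
  simp only [pois_succ, Finset.range_one, Finset.sum_singleton, Nat.cast_zero, mul_zero, sub_zero,
    zero_mul]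
  refine hasSum_conv ((pois_hasSum1 t).mul_left t) ?_ ?_
  · intro n; push_cast; ring
  · ring

lemma pois_var (t : ℝ) : HasSum (fun n : ℕ => pois t n * (n - t) ^ 2) t := by
  refine hasSum_conv (((pois_hasSum2 t).add ((pois_hasSum1 t).mul_left (1 - 2 * t))).add
    ((pois_hasSum t).mul_left (t ^ 2))) ?_ ?_
  · intro n; ring
  · ring

lemma pois_dev_summable {t : ℝ} (ht : 0 < t) :
    Summable (fun n : ℕ => pois t n * |1 - n / t|) ∧
    ∑' n : ℕ, pois t n * |1 - n / t| ≤ 1 / √t := by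
  have hs : 0 < √t := Real.sqrt_pos.2 ht
  have hst : √t ^ 2 = t := Real.sq_sqrt ht.le
  have hmaj : HasSum (fun n : ℕ => pois t n * (1 / (2 * √t)) +
      pois t n * (n - t) ^ 2 * (1 / (2 * √t ^ 3))) (1 / √t) := by
    refine hasSum_conv (((pois_hasSum t).mul_right (1 / (2 * √t))).add
      ((pois_var t).mul_right (1 / (2 * √t ^ 3)))) (fun _ => rfl) ?_
    have h3 : t * (1 / (2 * √t ^ 3)) = √t ^ 2 * (1 / (2 * √t ^ 3)) := by rw [hst]
    rw [h3]
    field_simp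
    norm_num
  have hle : ∀ n : ℕ, pois t n * |1 - n / t| ≤ pois t n * (1 / (2 * √t)) +
      pois t n * (n - t) ^ 2 * (1 / (2 * √t ^ 3)) := by
    intro n
    rw [mul_assoc, ← mul_add]
    refine mul_le_mul_of_nonneg_left ?_ (pois_nonneg ht n)
    have h1 : |1 - n / t| = |(n : ℝ) - t| / √t ^ 2 := by
      rw [hst, abs_sub_comm, ← abs_of_pos ht, ← abs_div, abs_of_pos ht]
      congr 1
      field_simp
    rw [h1, ← sq_abs ((n : ℝ) - t)]
    set a := |(n : ℝ) - t|
    have : 1 / (2 * √t) + a ^ 2 * (1 / (2 * √t ^ 3)) - a / √t ^ 2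
        = (a - √t) ^ 2 / (2 * √t ^ 3) := by
      field_simp
      ring
    have h2 : 0 ≤ (a - √t) ^ 2 / (2 * √t ^ 3) := by positivity
    linarith
  have hsum : Summable (fun n : ℕ => pois t n * |1 - n / t|) :=
    Summable.of_nonneg_of_le (fun n => mul_nonneg (pois_nonneg ht n) (abs_nonneg _)) hle
      hmaj.summable
  exact ⟨hsum, hmaj.tsum_eq ▸ hsum.tsum_le_tsum hle hmaj.summable⟩

/-- fibre sum of `F` over `m - n = z`. -/
noncomputable def fib (F : ℕ × ℕ → ℝ) (z : ℤ) : ℝ :=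
  ∑' p : ℕ × ℕ, if (p.1 : ℤ) - (p.2 : ℤ) = z then F p else 0

lemma fib_summable {F : ℕ × ℕ → ℝ} (hF : Summable F) (z : ℤ) :
    Summable (fun p : ℕ × ℕ => if (p.1 : ℤ) - (p.2 : ℤ) = z then F p else 0) := by
  have := hF.indicator {p : ℕ × ℕ | (p.1 : ℤ) - (p.2 : ℤ) = z}
  refine this.congr ?_
  intro p
  simp [Set.indicator_apply]

lemma fib_hasSum {F : ℕ × ℕ → ℝ} {a : ℝ} (hF : HasSum F a) : HasSum (fib F) a := by
  have h := hF.tsum_fiberwise (fun p : ℕ × ℕ => (p.1 : ℤ) - (p.2 : ℤ))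
  refine hasSum_conv h ?_ rfl
  intro z
  rw [_root_.tsum_subtype]
  unfold fib
  refine tsum_congr fun p => ?_
  by_cases hp : (p.1 : ℤ) - (p.2 : ℤ) = z
  · rw [if_pos hp, Set.indicator_of_mem (show p ∈ _ from hp)]
  · rw [if_neg hp, Set.indicator_of_notMem (show p ∉ _ from hp)]

lemma skellam_eq (t : ℝ) (z : ℤ) : skellam t z = fib (fun p => pois t p.1 * pois t p.2) z := rfl

lemma prod_hasSum {f g : ℕ → ℝ} {a b : ℝ} (hf : HasSum f a) (hg : HasSum g b)
    (hf0 : ∀ n, 0 ≤ f n) (hg0 : ∀ n, 0 ≤ g n) :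
    HasSum (fun p : ℕ × ℕ => f p.1 * g p.2) (a * b) :=
  hf.mul hg (hf.summable.mul_of_nonneg hg.summable hf0 hg0)

lemma G_hasSum {t : ℝ} (ht : 0 < t) :
    HasSum (fun p : ℕ × ℕ => pois t p.1 * pois t p.2) 1 := by
  simpa using prod_hasSum (pois_hasSum t) (pois_hasSum t) (pois_nonneg ht) (pois_nonneg ht)

lemma skellam_hasSum {t : ℝ} (ht : 0 < t) : HasSum (skellam t) 1 :=
  fib_hasSum (G_hasSum ht)

lemma skellam_nonneg {t : ℝ} (ht : 0 < t) (z : ℤ) : 0 ≤ skellam t z := by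
  refine tsum_nonneg fun p => ?_
  split_ifs
  · exact mul_nonneg (pois_nonneg ht _) (pois_nonneg ht _)
  · exact le_rfl

lemma skellam_sq {t : ℝ} (ht : 0 < t) :
    Summable (fun z : ℤ => skellam t z * (z : ℝ) ^ 2) ∧
    ∑' z : ℤ, skellam t z * (z : ℝ) ^ 2 ≤ 4 * t := by
  have h0 := pois_nonneg ht
  have hv0 : ∀ n : ℕ, 0 ≤ pois t n * ((n : ℝ) - t) ^ 2 :=
    fun n => mul_nonneg (h0 n) (sq_nonneg _)
  have h1 := ((prod_hasSum (pois_var t) (pois_hasSum t) hv0 h0).add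
    (prod_hasSum (pois_hasSum t) (pois_var t) h0 hv0)).mul_left 2
  have hle : ∀ p : ℕ × ℕ, pois t p.1 * pois t p.2 * (((p.1 : ℝ) - p.2) ^ 2) ≤
      2 * (pois t p.1 * ((p.1 : ℝ) - t) ^ 2 * pois t p.2 +
        pois t p.1 * (pois t p.2 * ((p.2 : ℝ) - t) ^ 2)) := by
    intro p
    have hG : 0 ≤ pois t p.1 * pois t p.2 := mul_nonneg (h0 _) (h0 _)
    have := mul_nonneg hG (sq_nonneg (((p.1 : ℝ) - t) + (p.2 - t)))
    nlinarith
  have hs : Summable (fun p : ℕ × ℕ => pois t p.1 * pois t p.2 * (((p.1 : ℝ) - p.2) ^ 2)) :=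
    Summable.of_nonneg_of_le
      (fun p => mul_nonneg (mul_nonneg (h0 _) (h0 _)) (sq_nonneg _)) hle h1.summable
  have hb := hs.tsum_le_tsum hle h1.summable
  rw [h1.tsum_eq] at hb
  have hf := fib_hasSum hs.hasSum
  have he : fib (fun p : ℕ × ℕ => pois t p.1 * pois t p.2 * (((p.1 : ℝ) - p.2) ^ 2)) =
      fun z : ℤ => skellam t z * (z : ℝ) ^ 2 := by
    funext z
    rw [skellam_eq]
    unfold fib
    rw [← tsum_mul_right]
    refine tsum_congr fun p => ?_
    split_ifs with h
    · rw [← h]; push_cast; rfl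
    · simp
  rw [he] at hf
  refine ⟨hf.summable, ?_⟩
  rw [hf.tsum_eq]
  linarith

lemma skellam_shift {t : ℝ} (ht : 0 < t) (z : ℤ) :
    skellam t (z - 1) = fib (fun p => pois t p.1 * pois t p.2 * (p.1 / t)) z := by
  rw [skellam_eq]
  unfold fib
  have hinj : Function.Injective (fun p : ℕ × ℕ => (p.1 + 1, p.2)) := by
    rintro ⟨a, b⟩ ⟨c, d⟩ h
    simp only [Prod.mk.injEq] at h ⊢
    omega
  refine Eq.trans ?_ (hinj.tsum_eq (f := fun p : ℕ × ℕ => if (p.1 : ℤ) - (p.2 : ℤ) = z then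
    pois t p.1 * pois t p.2 * (p.1 / t) else 0) ?_)
  · refine tsum_congr fun p => ?_
    have hiff : ((p.1 : ℤ) - p.2 = z - 1) ↔ (((p.1 + 1 : ℕ) : ℤ) - p.2 = z) := by
      push_cast; omega
    by_cases h : (p.1 : ℤ) - p.2 = z - 1
    · rw [if_pos h, if_pos (hiff.1 h)]
      have := pois_succ t p.1
      simp only
      field_simp
      linear_combination (-pois t p.2) * this
    · rw [if_neg h, if_neg (fun h' => h (hiff.2 h'))]
  · rintro ⟨a, b⟩ h
    rcases a with _ | a
    · simp at h
    · exact ⟨(a, b), rfl⟩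

lemma skellam_tv {t : ℝ} (ht : 0 < t) :
    Summable (fun z : ℤ => |skellam t z - skellam t (z - 1)|) ∧
    ∑' z : ℤ, |skellam t z - skellam t (z - 1)| ≤ 1 / √t := by
  have h0 := pois_nonneg ht
  obtain ⟨hs, hb⟩ := pois_dev_summable ht
  have hP := prod_hasSum hs.hasSum (pois_hasSum t)
    (fun n => mul_nonneg (h0 n) (abs_nonneg _)) h0
  have hf := fib_hasSum hP
  have h1 : HasSum (fun p : ℕ × ℕ => pois t p.1 * pois t p.2 * (p.1 / t)) (t / t * 1) := by
    refine hasSum_conv (prod_hasSum ((pois_hasSum1 t).div_const t) (pois_hasSum t)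
      (fun n => div_nonneg (mul_nonneg (h0 n) n.cast_nonneg) ht.le) h0) ?_ rfl
    intro p; ring
  have hle : ∀ z : ℤ, |skellam t z - skellam t (z - 1)| ≤
      fib (fun p : ℕ × ℕ => pois t p.1 * |1 - p.1 / t| * pois t p.2) z := by
    intro z
    rw [skellam_shift ht, skellam_eq]
    unfold fib
    rw [← (fib_summable (G_hasSum ht).summable z).tsum_sub (fib_summable h1.summable z)]
    have hps := fib_summable hP.summable z
    have hpt : ∀ p : ℕ × ℕ, ‖(if (p.1 : ℤ) - p.2 = z then pois t p.1 * pois t p.2 else 0) -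
        (if (p.1 : ℤ) - p.2 = z then pois t p.1 * pois t p.2 * (p.1 / t) else 0)‖ ≤
        (if (p.1 : ℤ) - p.2 = z then pois t p.1 * |1 - p.1 / t| * pois t p.2 else 0) := by
      intro p
      split_ifs
      · rw [Real.norm_eq_abs]
        have : pois t p.1 * pois t p.2 - pois t p.1 * pois t p.2 * (p.1 / t) =
          (pois t p.1 * pois t p.2) * (1 - p.1 / t) := by ring
        rw [this, abs_mul, abs_of_nonneg (mul_nonneg (h0 _) (h0 _))]
        exact le_of_eq (by ring)
      · simp
    exact tsum_of_norm_bounded hps.hasSum hpt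
  have hsum := Summable.of_nonneg_of_le (fun z => abs_nonneg _) hle hf.summable
  refine ⟨hsum, (hsum.tsum_le_tsum hle hf.summable).trans ?_⟩
  rw [hf.tsum_eq, mul_one]
  exact hb

lemma sum_blocks (g : ℕ → ℝ) (K W : ℕ) :
    ∑ n ∈ range (K * W), g n = ∑ a ∈ range K, ∑ j ∈ range W, g (a * W + j) := by
  induction K with
  | zero => simp
  | succ K ih => rw [Nat.succ_mul, sum_range_add, ih, sum_range_succ]

lemma abs_sub_le_var (g : ℕ → ℝ) (W : ℕ) : ∀ i j : ℕ, i ≤ j → j ≤ W →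
    |g j - g i| ≤ ∑ l ∈ range W, |g (l + 1) - g l| := by
  intro i j hij hj
  rw [← Finset.sum_Ico_sub g hij]
  refine (abs_sum_le_sum_abs _ _).trans ?_
  refine sum_le_sum_of_subset_of_nonneg ?_ (fun _ _ _ => abs_nonneg _)
  intro l hl
  simp at hl ⊢
  omega

lemma block_bound (g h : ℕ → ℝ) (W : ℕ) (hW : 0 < W) (ρ : ℝ) (hg : ∀ n, 0 ≤ g n)
    (hh : ∀ n, 0 ≤ h n) (hρ : ∑ j ∈ range W, h j ≤ ρ * W) :
    ∑ j ∈ range W, h j * g j ≤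
      ρ * ∑ j ∈ range W, g j + ρ * W * ∑ l ∈ range W, |g (l + 1) - g l| := by
  set V := ∑ l ∈ range W, |g (l + 1) - g l| with hV
  have hW' : (0 : ℝ) < W := by exact_mod_cast hW
  have hV0 : 0 ≤ V := sum_nonneg fun _ _ => abs_nonneg _
  have hpt : ∀ j ∈ range W, g j ≤ (∑ i ∈ range W, g i) / W + V := by
    intro j hj
    have hj := mem_range.1 hj
    have : ∀ i ∈ range W, g j ≤ g i + V := by
      intro i hi
      have hi := mem_range.1 hi
      rcases le_total i j with hij | hij
      · have := (abs_le.1 (abs_sub_le_var g W i j hij hj.le)).2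
        linarith
      · have := (abs_le.1 (abs_sub_le_var g W j i hij hi.le)).1
        linarith
    have := sum_le_sum this
    rw [sum_add_distrib] at this
    simp only [sum_const, card_range, nsmul_eq_mul] at this
    rw [div_add' _ _ _ hW'.ne', le_div_iff₀ hW']
    linarith
  have hS0 : 0 ≤ (∑ i ∈ range W, g i) / W + V :=
    add_nonneg (div_nonneg (sum_nonneg fun _ _ => hg _) hW'.le) hV0
  calc ∑ j ∈ range W, h j * g j
      ≤ ∑ j ∈ range W, h j * ((∑ i ∈ range W, g i) / W + V) :=
        sum_le_sum fun j hj => mul_le_mul_of_nonneg_left (hpt j hj) (hh j)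
    _ = (∑ j ∈ range W, h j) * ((∑ i ∈ range W, g i) / W + V) := by rw [sum_mul]
    _ ≤ ρ * W * ((∑ i ∈ range W, g i) / W + V) := mul_le_mul_of_nonneg_right hρ hS0
    _ = _ := by field_simp

lemma sum_range_le_tsum (f : ℤ → ℝ) (hf : Summable f) (h0 : ∀ z, 0 ≤ f z) (b : ℤ) (M : ℕ) :
    ∑ n ∈ range M, f (b + n) ≤ ∑' z, f z := by
  have hinj : Function.Injective (fun n : ℕ => b + (n : ℤ)) := by
    intro a c h; simpa using h
  have := hf.sum_le_tsum ((range M).map ⟨_, hinj⟩) (fun z _ => h0 z)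
  simpa using this

set_option maxHeartbeats 2000000 in
/-- the per-site estimate. -/
lemma site_bound (h : ℤ → ℝ) (h0 : ∀ z, 0 ≤ h z) (h1 : ∀ z, h z ≤ 1) (K W : ℕ) (hW : 0 < W)
    (b y : ℤ) (ρ t D : ℝ) (ht : 0 < t) (hρ0 : 0 ≤ ρ) (hρ1 : ρ ≤ 1) (hD : 0 < D)
    (hblock : ∀ a < K, ∑ j ∈ range W, h (b + ((a * W + j : ℕ) : ℤ)) ≤ ρ * W)
    (hfar : ∀ z : ℤ, z < b ∨ b + ((K * W : ℕ) : ℤ) ≤ z → D ^ 2 ≤ ((y - z : ℤ) : ℝ) ^ 2) :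
    Summable (fun z => h z * skellam t (y - z)) ∧
    ∑' z, h z * skellam t (y - z) ≤ ρ + W * (1 / √t) + 4 * t / D ^ 2 := by
  have q0 := skellam_nonneg ht
  have hq : HasSum (fun z => skellam t (y - z)) 1 :=
    (Equiv.subLeft y).hasSum_iff.2 (skellam_hasSum ht)
  obtain ⟨hv, hvb⟩ := skellam_sq ht
  have hv' : HasSum (fun z : ℤ => skellam t (y - z) * ((y - z : ℤ) : ℝ) ^ 2)
      (∑' z : ℤ, skellam t z * (z : ℝ) ^ 2) := (Equiv.subLeft y).hasSum_iff.2 hv.hasSum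
  obtain ⟨hd, hdb⟩ := skellam_tv ht
  have hd' : HasSum (fun z : ℤ => |skellam t (y - (z + 1)) - skellam t (y - z)|)
      (∑' z : ℤ, |skellam t z - skellam t (z - 1)|) := by
    refine hasSum_conv ((Equiv.subLeft y).hasSum_iff.2 hd.hasSum) ?_ rfl
    intro z
    simp only [Function.comp, Equiv.subLeft_apply]
    rw [abs_sub_comm]
    congr 3
    ring
  have hsum : Summable (fun z => h z * skellam t (y - z)) :=
    Summable.of_nonneg_of_le (fun z => mul_nonneg (h0 z) (q0 _))
      (fun z => mul_le_of_le_one_left (q0 _) (h1 z)) hq.summable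
  refine ⟨hsum, ?_⟩
  -- finite part
  have hfin : ∑ n ∈ range (K * W), h (b + n) * skellam t (y - (b + n)) ≤ ρ + W * (1 / √t) := by
    rw [sum_blocks (fun n => h (b + n) * skellam t (y - (b + n)))]
    have hb : ∀ a ∈ range K, ∑ j ∈ range W,
        h (b + ((a * W + j : ℕ) : ℤ)) * skellam t (y - (b + ((a * W + j : ℕ) : ℤ))) ≤
        ρ * ∑ j ∈ range W, skellam t (y - (b + ((a * W + j : ℕ) : ℤ))) +
        ρ * W * ∑ j ∈ range W, |skellam t (y - (b + ((a * W + j : ℕ) : ℤ) + 1)) -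
          skellam t (y - (b + ((a * W + j : ℕ) : ℤ)))| := by
      intro a ha
      have := block_bound (fun j => skellam t (y - (b + ((a * W + j : ℕ) : ℤ))))
        (fun j => h (b + ((a * W + j : ℕ) : ℤ))) W hW ρ (fun _ => q0 _) (fun _ => h0 _)
        (hblock a (mem_range.1 ha))
      convert this using 7
      push_cast; ring
    refine (sum_le_sum hb).trans ?_
    rw [sum_add_distrib, ← mul_sum, ← mul_sum,
      ← sum_blocks (fun n => skellam t (y - (b + n))),
      ← sum_blocks (fun n => |skellam t (y - (b + n + 1)) - skellam t (y - (b + n))|)]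
    have e1 := sum_range_le_tsum (fun z => skellam t (y - z)) hq.summable (fun _ => q0 _) b (K * W)
    rw [hq.tsum_eq] at e1
    have e2 := sum_range_le_tsum (fun z => |skellam t (y - (z + 1)) - skellam t (y - z)|)
      hd'.summable (fun _ => abs_nonneg _) b (K * W)
    rw [hd'.tsum_eq] at e2
    have e3 := e2.trans hdb
    have hW' : (0 : ℝ) < W := by exact_mod_cast hW
    have e4 : (0 : ℝ) ≤ 1 / √t := by positivity
    have e5 := mul_le_mul_of_nonneg_left e1 hρ0
    have e6 := mul_le_mul_of_nonneg_left e3 (mul_nonneg hρ0 hW'.le)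
    have e7 : ρ * W * (1 / √t) ≤ W * (1 / √t) := by
      rw [mul_assoc]
      exact mul_le_of_le_one_left (by positivity) hρ1
    linarith
  -- tail
  have hinj : Function.Injective (fun n : ℕ => b + (n : ℤ)) := by
    intro a c h; simpa using h
  set S : Finset ℤ := (range (K * W)).map ⟨_, hinj⟩ with hS
  have hSsum : HasSum (fun z => if z ∈ S then h z * skellam t (y - z) else 0)
      (∑ n ∈ range (K * W), h (b + n) * skellam t (y - (b + n))) := by
    have := hasSum_sum_of_ne_finset_zero (L := .unconditional ℤ) (f := fun z => if z ∈ S then h z * skellam t (y - z) else 0)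
      (s := S) (fun z hz => if_neg hz)
    refine hasSum_conv this (fun _ => rfl) ?_
    rw [sum_ite_mem, inter_self, hS, sum_map]
    rfl
  have hmaj := hSsum.add (hv'.div_const (D ^ 2))
  have hle : ∀ z, h z * skellam t (y - z) ≤ (if z ∈ S then h z * skellam t (y - z) else 0) +
      skellam t (y - z) * ((y - z : ℤ) : ℝ) ^ 2 / D ^ 2 := by
    intro z
    split_ifs with hz
    · have : 0 ≤ skellam t (y - z) * ((y - z : ℤ) : ℝ) ^ 2 / D ^ 2 :=
        div_nonneg (mul_nonneg (q0 _) (sq_nonneg _)) (sq_nonneg _)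
      linarith
    · have hz' : z < b ∨ b + ((K * W : ℕ) : ℤ) ≤ z := by
        by_contra hc
        push Not at hc
        apply hz
        rw [hS, mem_map]
        refine ⟨(z - b).toNat, mem_range.2 (by omega), ?_⟩
        simp only [Function.Embedding.coeFn_mk]
        omega
      have := hfar z hz'
      rw [zero_add, le_div_iff₀ (by positivity)]
      calc h z * skellam t (y - z) * D ^ 2 ≤ skellam t (y - z) * D ^ 2 :=
            mul_le_mul_of_nonneg_right (mul_le_of_le_one_left (q0 _) (h1 z)) (sq_nonneg _)
        _ ≤ _ := mul_le_mul_of_nonneg_left this (q0 _)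
  have := hsum.tsum_le_tsum hle hmaj.summable
  rw [hmaj.tsum_eq] at this
  have h4 : (∑' z : ℤ, skellam t z * (z : ℝ) ^ 2) / D ^ 2 ≤ 4 * t / D ^ 2 := by gcongr
  linarith

lemma rhoBar_mem (N₀ : ℕ) (hN₀ : 2 ≤ N₀) (r : ℕ) : 0 ≤ rhoBar N₀ r ∧ rhoBar N₀ r ≤ 1 := by
  have hN : (1 : ℝ) ≤ N₀ := by exact_mod_cast (by omega : 1 ≤ N₀)
  have ha : ∀ k : ℕ, (N₀ : ℝ) ^ (-(k : ℝ) / 4) ≤ 1 := fun k =>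
    Real.rpow_le_one_of_one_le_of_nonpos hN (by
      have : (0 : ℝ) ≤ k := k.cast_nonneg
      linarith)
  have hb : ∀ k : ℕ, 0 ≤ (N₀ : ℝ) ^ (-(k : ℝ) / 4) := fun k => by positivity
  exact ⟨prod_nonneg fun k _ => by linarith [ha k],
    prod_le_one (fun k _ => by linarith [ha k]) (fun k _ => by linarith [hb k])⟩

/-- first-moment estimate for independent random walkers started from the
holes of a locally dense configuration.  With `ω_r = N₀^r`, `Δ_r = N₀^{6r}`: if every
length-`ω_{r+1}` subinterval of `[−5Δ_{r+1}, 6Δ_{r+1})` carries at least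
`(1 − ρ̄_{r+1}) ω_{r+1}` particles of `η`, then for `x ∈ [−Δ_{r+1}, 2Δ_{r+1})` and
`t ∈ [Δ_{r+1}, 3Δ_{r+1})`, the expected number of walkers started from the holes of `η`
lying in `[x, x+ω_r)` at time `t` is at most `1 + ρ̄_{r+1} ω_r`. -/
theorem expected_holes_in_interval_le (N₀ : ℕ) (hN₀ : 2 ≤ N₀) :
    ∃ r₀ : ℕ, ∀ r : ℕ, r₀ ≤ r →
      ∀ η : ℤ → ℝ, (∀ z : ℤ, η z = 0 ∨ η z = 1) →
      (∀ x' : ℤ,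
          -5 * ((N₀ : ℤ) ^ (6 * (r + 1))) ≤ x' →
          x' + (N₀ : ℤ) ^ (r + 1) ≤ 6 * ((N₀ : ℤ) ^ (6 * (r + 1))) →
          (1 - rhoBar N₀ (r + 1)) * (N₀ : ℝ) ^ (r + 1) ≤
            ∑ i ∈ Finset.range (N₀ ^ (r + 1)), η (x' + (i : ℤ))) →
      ∀ x : ℤ,
        -((N₀ : ℤ) ^ (6 * (r + 1))) ≤ x →
        x < 2 * ((N₀ : ℤ) ^ (6 * (r + 1))) →
      ∀ t : ℝ,
        ((N₀ : ℝ) ^ (6 * (r + 1))) ≤ t →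
        t < 3 * ((N₀ : ℝ) ^ (6 * (r + 1))) →
        (∑' z : ℤ, (1 - η z) *
            ∑ i ∈ Finset.range (N₀ ^ r), skellam t ((x + (i : ℤ)) - z)) ≤
          1 + rhoBar N₀ (r + 1) * (N₀ : ℝ) ^ r := by
  refine ⟨0, fun r _ η hη hdense x hx1 hx2 t ht1 ht2 => ?_⟩
  obtain ⟨hρ0, hρ1⟩ := rhoBar_mem N₀ hN₀ (r + 1)
  set ρ := rhoBar N₀ (r + 1)
  have hNR : (2 : ℝ) ≤ N₀ := by exact_mod_cast hN₀
  have hNZ : (2 : ℤ) ≤ N₀ := by exact_mod_cast hN₀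
  have hN0 : (0 : ℝ) < N₀ := by linarith
  set W := N₀ ^ (r + 1) with hWdef
  have hW : 0 < W := by positivity
  set D := N₀ ^ (5 * (r + 1)) with hDdef
  have hΔN : W * D = N₀ ^ (6 * (r + 1)) := by rw [hWdef, hDdef, ← pow_add]; congr 1; ring
  have hΔZ : ((N₀ : ℤ) ^ (6 * (r + 1))) = W * D := by exact_mod_cast hΔN.symm
  have hΔR : ((N₀ : ℝ) ^ (6 * (r + 1))) = W * D := by exact_mod_cast hΔN.symm
  set Δ : ℝ := (N₀ : ℝ) ^ (6 * (r + 1)) with hΔ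
  set Z : ℤ := (N₀ : ℤ) ^ (6 * (r + 1)) with hZ
  have hZΔ : (Z : ℝ) = Δ := by rw [hZ, hΔ]; push_cast; rfl
  have hΔ0 : 0 < Δ := by positivity
  have ht : 0 < t := hΔ0.trans_le ht1
  have hωZ : ((N₀ : ℤ) ^ r) ≤ Z := pow_le_pow_right₀ (by omega) (by omega)
  have hsite : ∀ i ∈ range (N₀ ^ r),
      Summable (fun z => (1 - η z) * skellam t ((x + (i : ℤ)) - z)) ∧
      ∑' z, (1 - η z) * skellam t ((x + (i : ℤ)) - z) ≤
        ρ + W * (1 / √t) + 4 * t / (3 * Δ) ^ 2 := by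
    intro i hi
    have hi' : (i : ℤ) < (N₀ : ℤ) ^ r := by exact_mod_cast mem_range.1 hi
    refine site_bound (fun z => 1 - η z) (fun z => ?_) (fun z => ?_) (11 * D) W hW (-5 * Z)
      (x + i) ρ t (3 * Δ) ht hρ0 hρ1 (by positivity) ?_ ?_
    · rcases hη z with h | h <;> simp [h]
    · rcases hη z with h | h <;> simp [h]
    · intro a ha
      have key : ((a : ℤ) + 1) * W ≤ 11 * Z := by
        rw [hΔZ]
        have : (a : ℤ) + 1 ≤ 11 * D := by exact_mod_cast ha
        nlinarith [this, (by exact_mod_cast hW : (0 : ℤ) < W)]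
      have hWZ : ((N₀ : ℤ) ^ (r + 1)) = W := by rw [hWdef]; push_cast; rfl
      have haW : (0 : ℤ) ≤ (a : ℤ) * W := by positivity
      have := hdense (-5 * Z + ((a * W : ℕ) : ℤ)) (by push_cast; linarith)
        (by rw [hWZ]; push_cast; linarith)
      have hWR : ((N₀ : ℝ) ^ (r + 1)) = W := by rw [hWdef]; push_cast; rfl
      rw [hWR] at this
      simp only [sum_sub_distrib, sum_const, card_range, nsmul_eq_mul, mul_one]
      have he : ∑ j ∈ range W, η (-5 * Z + ((a * W + j : ℕ) : ℤ)) =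
          ∑ j ∈ range W, η (-5 * Z + ((a * W : ℕ) : ℤ) + (j : ℤ)) := by
        refine sum_congr rfl fun j _ => ?_
        congr 1; push_cast; ring
      rw [he]
      linarith
    · intro z hz
      have hKW : (((11 * D) * W : ℕ) : ℤ) = 11 * Z := by rw [hΔZ]; push_cast; ring
      rw [hKW] at hz
      have hi0 : (0 : ℤ) ≤ i := by positivity
      have : 3 * Z ≤ |x + i - z| := by
        rcases hz with hz | hz
        · exact le_trans (by omega) (le_abs_self _)
        · exact le_trans (by omega) (neg_le_abs _)
      have h3 : 3 * Δ ≤ |((x + i - z : ℤ) : ℝ)| := by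
        rw [← hZΔ]; exact_mod_cast this
      rw [← sq_abs ((x + i - z : ℤ) : ℝ)]
      exact pow_le_pow_left₀ (by positivity) h3 2
  have hswap : (∑' z : ℤ, (1 - η z) * ∑ i ∈ range (N₀ ^ r), skellam t ((x + (i : ℤ)) - z)) =
      ∑ i ∈ range (N₀ ^ r), ∑' z, (1 - η z) * skellam t ((x + (i : ℤ)) - z) := by
    simp only [mul_sum]
    exact Summable.tsum_finsetSum fun i hi => (hsite i hi).1
  rw [hswap]
  refine (sum_le_sum fun i hi => (hsite i hi).2).trans ?_
  rw [sum_const, card_range, nsmul_eq_mul]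
  push_cast
  -- numerical estimates
  set ω : ℝ := (N₀ : ℝ) ^ r with hω
  have hω1 : 1 ≤ ω := one_le_pow₀ (by linarith)
  have hWω : (W : ℝ) = ω * N₀ := by rw [hWdef, hω]; push_cast; rw [pow_succ]
  have hΔω : Δ = (ω * N₀) ^ 6 := by rw [hΔ, hω, ← pow_succ, ← pow_mul]; congr 1; ring
  have hωN : 2 ≤ ω * N₀ := by nlinarith
  set u := ω * N₀ with hu
  have hωu : ω ≤ u / 2 := by rw [hu]; nlinarith
  have hsq : u ^ 3 ≤ √t := by
    apply Real.le_sqrt_of_sq_le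
    rw [← pow_mul]; norm_num; linarith
  have hu0 : 0 < u := by linarith
  have g1 : ω * (W * (1 / √t)) ≤ 1 / 4 := by
    rw [hWω]
    have : 1 / √t ≤ 1 / u ^ 3 := one_div_le_one_div_of_le (by positivity) hsq
    calc ω * (u * (1 / √t)) ≤ (u / 2) * (u * (1 / u ^ 3)) := by gcongr
      _ = 1 / (2 * u) := by field_simp
      _ ≤ 1 / 4 := one_div_le_one_div_of_le (by norm_num) (by linarith)
  have g2 : ω * (4 * t / (3 * Δ) ^ 2) ≤ 3 / 4 := by
    have : 4 * t / (3 * Δ) ^ 2 ≤ 4 * (3 * Δ) / (3 * Δ) ^ 2 := by gcongr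
    have h2 : 4 * (3 * Δ) / (3 * Δ) ^ 2 = 4 / (3 * Δ) := by field_simp
    rw [h2] at this
    have hu5 : (2 : ℝ) ^ 5 ≤ u ^ 5 := by gcongr
    calc ω * (4 * t / (3 * Δ) ^ 2) ≤ (u / 2) * (4 / (3 * Δ)) := by gcongr
      _ = 2 / (3 * u ^ 5) := by rw [hΔω]; field_simp; norm_num
      _ ≤ 3 / 4 := by
        rw [div_le_iff₀ (by positivity)]; linarith
  nlinarith
end
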